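/- Let n ≥ 2 and let ν be an even, finite Borel measure on S^{n−1} with ν(S^{n−1}) > 0 that satisfies the strict subspace concentration inequality. Fix α ≠ 0 and let F be a positive, continuous, α-homogeneous functional on convex bodies of ℝⁿ satisfying properties (A) and (B). If (Q_l) is a sequence in 𝒦ⁿ_e with F(Q_l) = ν(S^{n−1}) for every l and sup_l Φ_ν(Q_l) < ∞, then the sequence (Q_l) is uniformly bounded: there exists R > 0 such that Q_l is contained in the closed ball of radius R centered at the origin for every l. -/

import Mathlib

open MeasureTheory Filter Topology
open scoped InnerProductSpace ENNReal Pointwise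

noncomputable section

/-- The unit sphere `S^{n-1}` of `ℝⁿ`. -/
def unitSphere (n : ℕ) : Set (EuclideanSpace ℝ (Fin n)) := Metric.sphere 0 1

/-- A convex body: compact, convex, with nonempty interior. -/
def IsConvexBody {n : ℕ} (K : Set (EuclideanSpace ℝ (Fin n))) : Prop :=
  IsCompact K ∧ Convex ℝ K ∧ (interior K).Nonempty

/-- The support function `h_K(u) = sup_{y ∈ K} ⟨y, u⟩`. -/
def suppFn {n : ℕ} (K : Set (EuclideanSpace ℝ (Fin n))) (u : EuclideanSpace ℝ (Fin n)) : ℝ :=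
  sSup ((fun y => ⟪y, u⟫_ℝ) '' K)

/-- The log-functional `Φ_ν(Q) = ∫ log h_Q dν`. -/
def logFunc {n : ℕ} (ν : Measure (EuclideanSpace ℝ (Fin n)))
    (Q : Set (EuclideanSpace ℝ (Fin n))) : ℝ :=
  ∫ u, Real.log (suppFn Q u) ∂ν

local notation "𝔼" n => EuclideanSpace ℝ (Fin n)

/-- Fewer than `n` vectors of `ℝⁿ` have a common orthogonal unit vector. -/
lemma exists_unit_orthogonal {n k : ℕ} (hk : k < n) (e : ℕ → 𝔼 n) :
    ∃ w : 𝔼 n, ‖w‖ = 1 ∧ ∀ j < k, ⟪w, e j⟫_ℝ = 0 := by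
  classical
  set V : Submodule ℝ (𝔼 n) := Submodule.span ℝ ((Finset.range k).image e : Set (𝔼 n)) with hV
  have hfin : Module.finrank ℝ V < n := by
    refine (finrank_span_finset_le_card _).trans_lt ?_
    exact (Finset.card_image_le.trans (by simp)).trans_lt hk
  have hadd := V.finrank_add_finrank_orthogonal
  rw [finrank_euclideanSpace_fin] at hadd
  have : Vᗮ ≠ ⊥ := by
    intro h
    rw [h, finrank_bot] at hadd
    omega
  obtain ⟨w, hw, hw0⟩ := Submodule.exists_mem_ne_zero_of_ne_bot this
  refine ⟨(‖w‖⁻¹ : ℝ) • w, norm_smul_inv_norm (𝕜 := ℝ) hw0, fun j hj => ?_⟩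
  have hej : e j ∈ V := Submodule.subset_span (by
    simp only [Finset.coe_image, Set.mem_image]
    exact ⟨j, by simpa using hj, rfl⟩)
  rw [real_inner_smul_left, Submodule.inner_left_of_mem_orthogonal hej hw, mul_zero]

/-- Greedy construction of an orthonormal frame adapted to a compact set. -/
lemma exists_greedy_frame {n : ℕ} {K : Set (𝔼 n)} (hK : IsCompact K) (hne : K.Nonempty) :
    ∃ e v : ℕ → 𝔼 n, ∀ i < n, v i ∈ K ∧ ‖e i‖ = 1 ∧ (∀ j < i, ⟪e i, e j⟫_ℝ = 0) ∧
      ∀ x ∈ K, ∀ w : 𝔼 n, ‖w‖ = 1 → (∀ j < i, ⟪w, e j⟫_ℝ = 0) → ⟪x, w⟫_ℝ ≤ ⟪v i, e i⟫_ℝ := by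
  suffices H : ∀ k ≤ n, ∃ e v : ℕ → 𝔼 n, ∀ i < k, v i ∈ K ∧ ‖e i‖ = 1 ∧
      (∀ j < i, ⟪e i, e j⟫_ℝ = 0) ∧
      ∀ x ∈ K, ∀ w : 𝔼 n, ‖w‖ = 1 → (∀ j < i, ⟪w, e j⟫_ℝ = 0) → ⟪x, w⟫_ℝ ≤ ⟪v i, e i⟫_ℝ from
    H n le_rfl
  intro k
  induction k with
  | zero => exact fun _ => ⟨0, 0, by simp⟩
  | succ k ih =>
    intro hk
    obtain ⟨e, v, hev⟩ := ih (by omega)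
    set W : Set (𝔼 n) := Metric.sphere 0 1 ∩ ⋂ j ∈ Set.Iio k, {w | ⟪w, e j⟫_ℝ = 0} with hW
    have memW : ∀ w, w ∈ W ↔ ‖w‖ = 1 ∧ ∀ j < k, ⟪w, e j⟫_ℝ = 0 := by
      intro w; simp [hW]
    have hWc : IsCompact W := by
      refine (isCompact_sphere _ _).inter_right (isClosed_biInter fun j _ => ?_)
      exact isClosed_eq (by fun_prop) continuous_const
    have hWne : W.Nonempty := by
      obtain ⟨w, hw⟩ := exists_unit_orthogonal (by omega : k < n) e
      exact ⟨w, (memW w).2 hw⟩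
    obtain ⟨⟨v₀, e₀⟩, ⟨hv₀, he₀⟩, hmax⟩ := (hK.prod hWc).exists_isMaxOn (hne.prod hWne)
      (f := fun p : (𝔼 n) × (𝔼 n) => ⟪p.1, p.2⟫_ℝ) (by fun_prop)
    have he₀' := (memW e₀).1 he₀
    refine ⟨Function.update e k e₀, Function.update v k v₀, fun i hi => ?_⟩
    have hupd : ∀ j < k, Function.update e k e₀ j = e j := fun j hj =>
      Function.update_of_ne (by omega) _ _
    rcases (Nat.lt_succ_iff_lt_or_eq.1 hi) with hi | rfl
    · rw [hupd i hi, Function.update_of_ne (by omega)]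
      obtain ⟨h1, h2, h3, h4⟩ := hev i hi
      refine ⟨h1, h2, fun j hj => ?_, fun x hx w hw hwj => h4 x hx w hw fun j hj => ?_⟩
      · rw [hupd j (by omega)]; exact h3 j hj
      · rw [← hupd j (by omega)]; exact hwj j hj
    · simp only [Function.update_self]
      refine ⟨hv₀, he₀'.1, fun j hj => ?_, fun x hx w hw hwj => ?_⟩
      · rw [hupd j hj]; exact he₀'.2 j hj
      · refine hmax (a := (x, w)) ⟨hx, (memW w).2 ⟨hw, fun j hj => ?_⟩⟩
        rw [← hupd j hj]; exact hwj j hj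

lemma inner_le_suppFn {n : ℕ} {K : Set (𝔼 n)} (hK : IsCompact K) {x : 𝔼 n} (hx : x ∈ K)
    (u : 𝔼 n) : ⟪x, u⟫_ℝ ≤ suppFn K u :=
  le_csSup (hK.image (by fun_prop)).bddAbove ⟨x, hx, rfl⟩

lemma abs_inner_le_suppFn {n : ℕ} {K : Set (𝔼 n)} (hK : IsCompact K) (hsym : K = -K)
    {x : 𝔼 n} (hx : x ∈ K) (u : 𝔼 n) : |⟪x, u⟫_ℝ| ≤ suppFn K u := by
  refine abs_le'.2 ⟨inner_le_suppFn hK hx u, ?_⟩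
  have hx' : -x ∈ K := by rw [hsym]; simpa using hx
  simpa using inner_le_suppFn hK hx' u

lemma exists_orthonormalBasis_eq {n : ℕ} {e : Fin n → 𝔼 n} (he : Orthonormal ℝ e) :
    ∃ b : OrthonormalBasis (Fin n) ℝ (𝔼 n), ∀ i, b i = e i :=
  ⟨OrthonormalBasis.mk he
    (he.linearIndependent.span_eq_top_of_card_eq_finrank' (by simp)).ge, fun i => by simp⟩

/-- An elementary substitute for John's position: a compact symmetric set lies in a box of
half-widths `a` with respect to an orthonormal frame, and its support function dominates, up to a
dimensional constant, that of the box. -/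
lemma exists_adapted_frame {n : ℕ} {K : Set (𝔼 n)} (hK : IsCompact K)
    (hne : K.Nonempty) (hsym : K = -K) :
    ∃ (e : ℕ → 𝔼 n) (a : ℕ → ℝ), Orthonormal ℝ (fun i : Fin n => e i) ∧
      (∀ i j, i ≤ j → j < n → a j ≤ a i) ∧
      (∀ x ∈ K, ∀ i < n, |⟪e i, x⟫_ℝ| ≤ a i) ∧
      (0 < n → ∀ x ∈ K, ‖x‖ ≤ a 0) ∧
      ∀ u, ∀ i < n, a i * |⟪e i, u⟫_ℝ| ≤ 2 ^ n * suppFn K u := by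
  obtain ⟨e, v, hev⟩ := exists_greedy_frame hK hne
  have hneg : ∀ x ∈ K, -x ∈ K := fun x hx => by rw [hsym]; simpa using hx
  have horth : ∀ i < n, ∀ j < n, i ≠ j → ⟪e i, e j⟫_ℝ = 0 := by
    intro i hi j hj hij
    rcases lt_or_gt_of_ne hij with h | h
    · rw [real_inner_comm]; exact (hev j hj).2.2.1 i h
    · exact (hev i hi).2.2.1 j h
  have hon : Orthonormal ℝ (fun i : Fin n => e i) :=
    ⟨fun i => (hev i i.2).2.1, fun i j hij => horth i i.2 j j.2 (by simpa [Fin.ext_iff] using hij)⟩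
  have hbox : ∀ x ∈ K, ∀ i < n, |⟪e i, x⟫_ℝ| ≤ ⟪v i, e i⟫_ℝ := by
    intro x hx i hi
    obtain ⟨h1, h2, h3, h4⟩ := hev i hi
    rw [real_inner_comm]
    refine abs_le'.2 ⟨h4 x hx _ h2 h3, ?_⟩
    rw [← inner_neg_left]
    exact h4 _ (hneg x hx) _ h2 h3
  have htri : ∀ i < n, ∀ j < n, i < j → ⟪v i, e j⟫_ℝ = 0 := by
    intro i hi j hj hij
    obtain ⟨h1, h2, h3, h4⟩ := hev i hi
    set p := ⟪v i, e i⟫_ℝ with hp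
    set q := ⟪v i, e j⟫_ℝ with hq
    by_contra hq0
    have hpos : 0 < p ^ 2 + q ^ 2 := by positivity
    set y : 𝔼 n := p • e i + q • e j with hy
    have hyy : ‖y‖ ^ 2 = p ^ 2 + q ^ 2 := by
      rw [hy, norm_add_sq_real, norm_smul, norm_smul, h2, (hev j hj).2.1,
        real_inner_smul_left, real_inner_smul_right, horth i hi j hj hij.ne]
      simp
    have hy0 : 0 < ‖y‖ := by
      rcases (norm_nonneg y).eq_or_lt with h | h
      · rw [← h] at hyy; nlinarith
      · exact h
    have := h4 (v i) h1 ((‖y‖⁻¹ : ℝ) • y)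
      (norm_smul_inv_norm (𝕜 := ℝ) (norm_pos_iff.1 hy0)) (fun k hk => by
        rw [real_inner_smul_left, hy, inner_add_left, real_inner_smul_left, real_inner_smul_left,
          h3 k hk, horth j hj k (by omega) (by omega)]
        simp)
    have hvy : ⟪v i, y⟫_ℝ = ‖y‖ ^ 2 := by
      rw [hyy, hy, inner_add_right, real_inner_smul_right, real_inner_smul_right]
      ring
    rw [real_inner_smul_right, hvy] at this
    have h5 : ‖y‖⁻¹ * ‖y‖ ^ 2 = ‖y‖ := by field_simp
    rw [h5] at this
    have : 0 < q ^ 2 := by positivity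
    nlinarith
  refine ⟨e, fun i => ⟪v i, e i⟫_ℝ, hon, ?_, hbox, ?_, ?_⟩
  · intro i j hij hj
    obtain ⟨h1, h2, h3, h4⟩ := hev i (by omega)
    exact h4 _ (hev j hj).1 _ (hev j hj).2.1 fun k hk => (hev j hj).2.2.1 k (by omega)
  · intro hn x hx
    by_cases hx0 : x = 0
    · subst hx0
      have := hbox 0 hx 0 hn
      simpa using this
    · have := (hev 0 hn).2.2.2 x hx ((‖x‖⁻¹ : ℝ) • x)
        (norm_smul_inv_norm (𝕜 := ℝ) hx0) (by simp)
      rw [real_inner_smul_right, real_inner_self_eq_norm_sq] at this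
      have hx1 : ‖x‖ ≠ 0 := norm_ne_zero_iff.2 hx0
      have h5 : ‖x‖⁻¹ * ‖x‖ ^ 2 = ‖x‖ := by field_simp
      rwa [h5] at this
  · intro u
    obtain ⟨b, hbe⟩ := exists_orthonormalBasis_eq hon
    have hsum : ∀ i < n, ⟪v i, u⟫_ℝ = ∑ j ∈ Finset.range (i + 1), ⟪v i, e j⟫_ℝ * ⟪e j, u⟫_ℝ := by
      intro i hi
      rw [← b.sum_inner_mul_inner]
      simp only [hbe]
      rw [Fin.sum_univ_eq_sum_range (fun j => ⟪v i, e j⟫_ℝ * ⟪e j, u⟫_ℝ)]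
      symm
      refine Finset.sum_subset (Finset.range_mono (by omega)) fun j hj hj' => ?_
      rw [htri i hi j (by simpa using hj) (by simp at hj'; omega), zero_mul]
    have hh : 0 ≤ suppFn K u := by
      obtain ⟨x, hx⟩ := hne
      exact (abs_nonneg _).trans (abs_inner_le_suppFn hK hsym hx u)
    have key : ∀ i < n, ⟪v i, e i⟫_ℝ * |⟪e i, u⟫_ℝ| ≤ 2 ^ i * suppFn K u := by
      intro i
      induction i using Nat.strong_induction_on with
      | _ i ih =>
        intro hi
        have hai : 0 ≤ ⟪v i, e i⟫_ℝ := (abs_nonneg _).trans (hbox _ (hev i hi).1 i hi)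
        have h1 := hsum i hi
        rw [Finset.sum_range_succ] at h1
        have h2 : |∑ j ∈ Finset.range i, ⟪v i, e j⟫_ℝ * ⟪e j, u⟫_ℝ|
            ≤ ∑ j ∈ Finset.range i, 2 ^ j * suppFn K u := by
          refine (Finset.abs_sum_le_sum_abs _ _).trans (Finset.sum_le_sum fun j hj => ?_)
          have hj' : j < i := by simpa using hj
          refine le_trans ?_ (ih j hj' (by omega))
          rw [abs_mul]
          refine mul_le_mul_of_nonneg_right ?_ (abs_nonneg _)
          rw [real_inner_comm]
          exact hbox _ (hev i hi).1 j (by omega)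
        rw [← Finset.sum_mul, geom_sum_eq (by norm_num)] at h2
        have h3 := abs_inner_le_suppFn hK hsym (hev i hi).1 u
        have h4 : ⟪v i, e i⟫_ℝ * |⟪e i, u⟫_ℝ| = |⟪v i, e i⟫_ℝ * ⟪e i, u⟫_ℝ| := by
          rw [abs_mul, abs_of_nonneg hai]
        have h5 : ⟪v i, e i⟫_ℝ * ⟪e i, u⟫_ℝ
            = ⟪v i, u⟫_ℝ - ∑ j ∈ Finset.range i, ⟪v i, e j⟫_ℝ * ⟪e j, u⟫_ℝ := by linarith
        rw [h4, h5]
        refine (abs_sub _ _).trans ?_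
        linarith
    intro i hi
    refine (key i hi).trans (mul_le_mul_of_nonneg_right ?_ hh)
    exact pow_le_pow_right₀ (by norm_num) hi.le

/-- The volume of a set contained in a box with respect to an orthonormal frame. -/
lemma volume_le_of_subset_box {n : ℕ} {K : Set (𝔼 n)} {e : ℕ → 𝔼 n} {a : ℕ → ℝ}
    (hon : Orthonormal ℝ (fun i : Fin n => e i)) (ha : ∀ i < n, 0 ≤ a i)
    (hbox : ∀ x ∈ K, ∀ i < n, |⟪e i, x⟫_ℝ| ≤ a i) :
    (volume K).toReal ≤ 2 ^ n * ∏ i ∈ Finset.range n, a i := by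
  obtain ⟨b, hbe⟩ := exists_orthonormalBasis_eq hon
  set B : Set (Fin n → ℝ) := Set.Icc (fun i => -a i) (fun i => a i) with hB
  have hmp : MeasurePreserving (fun x : 𝔼 n => (b.repr x).ofLp) volume volume :=
    (PiLp.volume_preserving_ofLp (Fin n)).comp b.measurePreserving_repr
  have hsub : K ⊆ (fun x : 𝔼 n => (b.repr x).ofLp) ⁻¹' B := by
    intro x hx
    simp only [hB, Set.mem_preimage, Set.mem_Icc, Pi.le_def, b.repr_apply_apply, hbe]
    exact ⟨fun i => (abs_le.1 (hbox x hx i i.2)).1, fun i => (abs_le.1 (hbox x hx i i.2)).2⟩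
  have hvol : volume ((fun x : 𝔼 n => (b.repr x).ofLp) ⁻¹' B)
      = ∏ i : Fin n, ENNReal.ofReal (2 * a i) := by
    rw [hmp.measure_preimage measurableSet_Icc.nullMeasurableSet, Real.volume_Icc_pi]
    refine Finset.prod_congr rfl fun i _ => ?_
    congr 1; ring
  have h1 : volume K ≤ ENNReal.ofReal (∏ i : Fin n, (2 * a i)) := by
    rw [ENNReal.ofReal_prod_of_nonneg fun i _ => by have := ha i i.2; positivity, ← hvol]
    exact measure_mono hsub
  have h2 : ∏ i : Fin n, (2 * a i) = 2 ^ n * ∏ i ∈ Finset.range n, a i := by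
    rw [Finset.prod_mul_distrib, Fin.prod_univ_eq_prod_range a]; simp
  rw [h2] at h1
  refine ENNReal.toReal_le_of_le_ofReal ?_ h1
  have := Finset.prod_nonneg (s := Finset.range n) (f := a) fun i hi => ha i (by simpa using hi)
  positivity

/-- Strict subspace concentration for the orthogonal complement of part of a frame. -/
lemma measureReal_orthogonal_lt {n : ℕ} {ν : Measure (𝔼 n)} [IsFiniteMeasure ν]
    (hνscc : ∀ H : Submodule ℝ (EuclideanSpace ℝ (Fin n)),
      0 < Module.finrank ℝ H → Module.finrank ℝ H < n →
      ν ((H : Set (EuclideanSpace ℝ (Fin n))) ∩ unitSphere n)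
        < ((Module.finrank ℝ H : ℝ≥0∞) / (n : ℝ≥0∞)) * ν (unitSphere n))
    {k : ℕ} (hk0 : 0 < k) (hkn : k < n) {e : Fin n → 𝔼 n} (he : Orthonormal ℝ e) :
    ν.real (unitSphere n ∩ {u | ∀ j : Fin n, (j : ℕ) < k → ⟪e j, u⟫_ℝ = 0})
      < ((n : ℝ) - k) / n * ν.real (unitSphere n) := by
  set f : Fin k → 𝔼 n := fun i => e (Fin.castLE hkn.le i) with hf
  have hfo : Orthonormal ℝ f := he.comp _ (Fin.castLE_injective _)
  set V : Submodule ℝ (𝔼 n) := Submodule.span ℝ (Set.range f) with hV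
  have h1 : Module.finrank ℝ V = k := by
    rw [hV, finrank_span_eq_card hfo.linearIndependent, Fintype.card_fin]
  have hadd := V.finrank_add_finrank_orthogonal
  rw [finrank_euclideanSpace_fin, h1] at hadd
  have h2 : Module.finrank ℝ Vᗮ = n - k := by omega
  have h3 : (unitSphere n ∩ {u | ∀ j : Fin n, (j : ℕ) < k → ⟪e j, u⟫_ℝ = 0})
      = (Vᗮ : Set (𝔼 n)) ∩ unitSphere n := by
    rw [Set.inter_comm]
    congr 1
    ext u
    simp only [Set.mem_ofPred_eq, SetLike.mem_coe]
    constructor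
    · intro h
      rw [Submodule.mem_orthogonal]
      intro w hw
      induction hw using Submodule.span_induction with
      | mem x hx =>
        obtain ⟨i, rfl⟩ := hx
        exact h _ (by simp)
      | zero => simp
      | add x y _ _ hx hy => rw [inner_add_left, hx, hy, add_zero]
      | smul c x _ hx => rw [real_inner_smul_left, hx, mul_zero]
    · intro h j hj
      have hej : e j ∈ V := Submodule.subset_span (Set.mem_range.2 ⟨⟨j, hj⟩, by simp [hf]⟩)
      exact Submodule.inner_right_of_mem_orthogonal hej h
  have h4 := hνscc Vᗮ (by omega) (by omega)
  rw [← h3, h2] at h4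
  have h5 := (ENNReal.toReal_lt_toReal (measure_ne_top _ _) (by
    refine ENNReal.mul_ne_top (ENNReal.div_ne_top (by simp) ?_) (measure_ne_top _ _)
    have : n ≠ 0 := by omega
    exact_mod_cast this)).2 h4
  rw [ENNReal.toReal_mul, ENNReal.toReal_div, ENNReal.toReal_natCast, ENNReal.toReal_natCast,
    Nat.cast_sub hkn.le] at h5
  exact h5

/-- The compact set of orthonormal frames. -/
lemma isCompact_orthonormal (n : ℕ) : IsCompact {e : Fin n → 𝔼 n | Orthonormal ℝ e} := by
  classical
  refine Metric.isCompact_of_isClosed_isBounded ?_ ?_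
  · simp only [orthonormal_iff_ite, Set.ofPred_forall]
    exact isClosed_iInter fun i => isClosed_iInter fun j =>
      isClosed_eq (by fun_prop) continuous_const
  · refine (Metric.isBounded_closedBall (x := (0 : Fin n → 𝔼 n)) (r := 1)).subset ?_
    intro e he
    rw [mem_closedBall_zero_iff, pi_norm_le_iff_of_nonneg zero_le_one]
    exact fun i => (he.1 i).le

/-- Uniform form of the strict subspace concentration inequality: neighbourhoods of subspaces
carry uniformly less than the critical mass. -/
lemma exists_uniform_concentration {n : ℕ} {ν : Measure (𝔼 n)} [IsFiniteMeasure ν]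
    (hνscc : ∀ H : Submodule ℝ (EuclideanSpace ℝ (Fin n)),
      0 < Module.finrank ℝ H → Module.finrank ℝ H < n →
      ν ((H : Set (EuclideanSpace ℝ (Fin n))) ∩ unitSphere n)
        < ((Module.finrank ℝ H : ℝ≥0∞) / (n : ℝ≥0∞)) * ν (unitSphere n))
    {r : ℝ} (hr : 0 < r) :
    ∃ δ, 0 < δ ∧ δ < r ∧ ∀ k : ℕ, 0 < k → k < n → ∀ e : Fin n → 𝔼 n, Orthonormal ℝ e →
      ν.real (unitSphere n ∩ {u | ∀ j : Fin n, (j : ℕ) < k → |⟪e j, u⟫_ℝ| < δ})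
        ≤ ((n : ℝ) - k) / n * ν.real (unitSphere n) - δ := by
  have hloc : ∀ k : ℕ, 0 < k → k < n → ∀ e₀ : Fin n → 𝔼 n, Orthonormal ℝ e₀ →
      ∀ᶠ z : ℝ × (Fin n → 𝔼 n) in 𝓝 (0, e₀),
        ν.real (unitSphere n ∩ {u | ∀ j : Fin n, (j : ℕ) < k → |⟪z.2 j, u⟫_ℝ| < z.1})
          ≤ ((n : ℝ) - k) / n * ν.real (unitSphere n) - z.1 := by
    intro k hk0 hkn e₀ he₀
    set S : ℕ → Set (𝔼 n) := fun p =>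
      unitSphere n ∩ {u | ∀ j : Fin n, (j : ℕ) < k → |⟪e₀ j, u⟫_ℝ| ≤ 1 / ((p : ℝ) + 1)} with hS
    have hSclosed : ∀ p, IsClosed (S p) := by
      intro p
      refine Metric.isClosed_sphere.inter ?_
      simp only [Set.ofPred_forall]
      exact isClosed_iInter fun i => isClosed_iInter fun j =>
        isClosed_le (by fun_prop) continuous_const
    have hanti : Antitone S := by
      intro p q hpq u hu
      exact ⟨hu.1, fun j hj => (hu.2 j hj).trans (Nat.one_div_le_one_div hpq)⟩
    have hInter : ⋂ p, S p
        = unitSphere n ∩ {u | ∀ j : Fin n, (j : ℕ) < k → ⟪e₀ j, u⟫_ℝ = 0} := by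
      ext u
      simp only [Set.mem_iInter]
      constructor
      · intro h
        refine ⟨(h 0).1, fun j hj => ?_⟩
        have : |⟪e₀ j, u⟫_ℝ| ≤ 0 :=
          ge_of_tendsto' tendsto_one_div_add_atTop_nhds_zero_nat fun p => (h p).2 j hj
        exact abs_nonpos_iff.1 this
      · intro h p
        refine ⟨h.1, fun j hj => ?_⟩
        rw [h.2 j hj, abs_zero]
        positivity
    have htend := tendsto_measure_iInter_atTop (μ := ν)
      (fun p => (hSclosed p).measurableSet.nullMeasurableSet) hanti ⟨0, measure_ne_top _ _⟩
    rw [hInter] at htend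
    have htend' := ((ENNReal.tendsto_toReal (measure_ne_top _ _)).comp htend).add
      (tendsto_one_div_add_atTop_nhds_zero_nat (𝕜 := ℝ))
    have hlt := measureReal_orthogonal_lt hνscc hk0 hkn he₀
    rw [add_zero] at htend'
    obtain ⟨p, hp⟩ := (htend'.eventually_lt_const hlt).exists
    set η : ℝ := 1 / ((p : ℝ) + 1) with hη
    have hη0 : 0 < η := by positivity
    have hp' : ν.real (S p) + η < ((n : ℝ) - k) / n * ν.real (unitSphere n) := hp
    have e1 : ∀ᶠ z : ℝ × (Fin n → 𝔼 n) in 𝓝 (0, e₀), z.1 < η / 2 :=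
      (continuous_fst.tendsto (0, e₀)).eventually_lt_const (half_pos hη0)
    have e2 : ∀ᶠ z : ℝ × (Fin n → 𝔼 n) in 𝓝 (0, e₀), ‖e₀ - z.2‖ < η / 2 := by
      have : Tendsto (fun z : ℝ × (Fin n → 𝔼 n) => ‖e₀ - z.2‖) (𝓝 (0, e₀)) (𝓝 ‖e₀ - e₀‖) :=
        Continuous.tendsto (by fun_prop) (0, e₀)
      refine this.eventually_lt_const ?_
      simpa using hη0
    filter_upwards [e1, e2] with z h1 h2
    have hsub : (unitSphere n ∩ {u | ∀ j : Fin n, (j : ℕ) < k → |⟪z.2 j, u⟫_ℝ| < z.1}) ⊆ S p := by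
      rintro u ⟨hu1, hu2⟩
      refine ⟨hu1, fun j hj => ?_⟩
      have hu : ‖u‖ = 1 := by simpa [unitSphere] using hu1
      have h3 : ⟪e₀ j, u⟫_ℝ = ⟪z.2 j, u⟫_ℝ + ⟪e₀ j - z.2 j, u⟫_ℝ := by
        rw [inner_sub_left]; ring
      have h4 : |⟪e₀ j - z.2 j, u⟫_ℝ| ≤ ‖e₀ - z.2‖ := by
        refine (abs_real_inner_le_norm _ _).trans ?_
        rw [hu, mul_one]
        exact norm_le_pi_norm (e₀ - z.2) j
      rw [h3]
      refine (abs_add_le _ _).trans ?_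
      have := hu2 j hj
      change _ ≤ η
      linarith
    have := measureReal_mono hsub (measure_ne_top ν _)
    linarith
  have hunif : ∀ k : Fin n, 0 < (k : ℕ) → ∀ᶠ t : ℝ in 𝓝 0, ∀ e ∈ {e : Fin n → 𝔼 n | Orthonormal ℝ e},
      ν.real (unitSphere n ∩ {u | ∀ j : Fin n, (j : ℕ) < k → |⟪e j, u⟫_ℝ| < t})
        ≤ ((n : ℝ) - (k : ℕ)) / n * ν.real (unitSphere n) - t := fun k hk0 =>
    (isCompact_orthonormal n).eventually_forall_of_forall_eventually
      (P := fun t e => ν.real (unitSphere n ∩ {u | ∀ j : Fin n, (j : ℕ) < k → |⟪e j, u⟫_ℝ| < t})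
        ≤ ((n : ℝ) - (k : ℕ)) / n * ν.real (unitSphere n) - t)
      fun e he => hloc k hk0 k.2 e he
  have hall : ∀ᶠ t : ℝ in 𝓝[>] 0, 0 < t ∧ t < r ∧ ∀ k : Fin n, 0 < (k : ℕ) →
      ∀ e ∈ {e : Fin n → 𝔼 n | Orthonormal ℝ e},
      ν.real (unitSphere n ∩ {u | ∀ j : Fin n, (j : ℕ) < k → |⟪e j, u⟫_ℝ| < t})
        ≤ ((n : ℝ) - (k : ℕ)) / n * ν.real (unitSphere n) - t := by
    refine (eventually_mem_nhdsWithin).and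
      (Filter.Eventually.and (eventually_nhdsWithin_of_eventually_nhds (eventually_lt_nhds hr)) ?_)
    refine eventually_nhdsWithin_of_eventually_nhds (eventually_all.2 fun k => ?_)
    by_cases hk : 0 < (k : ℕ)
    · exact (hunif k hk).mono fun t ht _ => ht
    · exact Eventually.of_forall fun t h => absurd h hk
  obtain ⟨δ, h1, h2, h3⟩ := hall.exists
  exact ⟨δ, h1, h2, fun k hk0 hkn e he => h3 ⟨k, hkn⟩ hk0 e he⟩

lemma sum_range_mul_sub (L : ℕ → ℝ) (N : ℕ) :
    ∑ k ∈ Finset.range N, ((N : ℝ) - k) * (L k - L (k + 1))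
      = (N + 1) * L 0 - ∑ k ∈ Finset.range (N + 1), L k := by
  induction N with
  | zero => simp
  | succ N ih =>
    have h : ∑ k ∈ Finset.range (N + 1), (((N + 1 : ℕ) : ℝ) - k) * (L k - L (k + 1))
        = ∑ k ∈ Finset.range (N + 1), ((N : ℝ) - k) * (L k - L (k + 1))
          + ∑ k ∈ Finset.range (N + 1), (L k - L (k + 1)) := by
      rw [← Finset.sum_add_distrib]
      refine Finset.sum_congr rfl fun k _ => ?_
      push_cast; ring
    rw [h, Finset.sum_range_succ, ih, Finset.sum_range_sub', Finset.sum_range_succ _ (N + 1)]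
    push_cast; ring

lemma continuous_suppFn {n : ℕ} {K : Set (𝔼 n)} (hK : IsCompact K) :
    Continuous (suppFn K) :=
  hK.continuous_sSup (f := fun u y => ⟪y, u⟫_ℝ) (by fun_prop)

/-- A unit vector has a coordinate that is not too small. -/
lemma exists_coord_ge {n : ℕ} {e : ℕ → 𝔼 n} (hon : Orthonormal ℝ (fun i : Fin n => e i))
    {δ : ℝ} (hδ0 : 0 < δ) (hδ : δ < 1 / n) {u : 𝔼 n} (hu : ‖u‖ = 1) :
    ∃ j < n, δ ≤ |⟪e j, u⟫_ℝ| := by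
  obtain ⟨b, hbe⟩ := exists_orthonormalBasis_eq hon
  by_contra! h
  have hn : 0 < (n : ℝ) := by
    by_contra h0
    have : (n : ℝ) = 0 := le_antisymm (not_lt.1 h0) (by positivity)
    rw [this] at hδ; simp at hδ; linarith
  have hn1 : (1 : ℝ) ≤ n := by exact_mod_cast hn
  have h1 := b.sum_sq_norm_inner_right u
  rw [hu] at h1
  have h2 : ∑ i, ‖⟪b i, u⟫_ℝ‖ ^ 2 ≤ ∑ _i : Fin n, δ ^ 2 := by
    refine Finset.sum_le_sum fun i _ => ?_
    rw [hbe, Real.norm_eq_abs]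
    exact pow_le_pow_left₀ (abs_nonneg _) (h i i.2).le 2
  rw [h1] at h2
  simp only [Finset.sum_const, Finset.card_univ, Fintype.card_fin, nsmul_eq_mul] at h2
  rw [lt_div_iff₀ hn] at hδ
  nlinarith

/-- Lower bound of the log-functional by the half-widths of an adapted frame. -/
lemma le_logFunc {N : ℕ} {ν : Measure (𝔼 (N + 1))} [IsFiniteMeasure ν]
    (hνsupp : ν (unitSphere (N + 1))ᶜ = 0) {K : Set (𝔼 (N + 1))} (hK : IsCompact K)
    {e : ℕ → 𝔼 (N + 1)} {a : ℕ → ℝ} (hon : Orthonormal ℝ (fun i : Fin (N + 1) => e i))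
    (ha : ∀ i < N + 1, 0 < a i) (hanti : ∀ i j, i ≤ j → j < N + 1 → a j ≤ a i)
    (hdom : ∀ u, ∀ i < N + 1, a i * |⟪e i, u⟫_ℝ| ≤ 2 ^ (N + 1) * suppFn K u)
    {δ : ℝ} (hδ0 : 0 < δ) (hδ : δ < 1 / (N + 1 : ℕ))
    (hconc : ∀ k : ℕ, 0 < k → k < N + 1 →
      ν.real (unitSphere (N + 1) ∩ {u | ∀ j : Fin (N + 1), (j : ℕ) < k → |⟪e j, u⟫_ℝ| < δ})
        ≤ (((N + 1 : ℕ) : ℝ) - k) / (N + 1 : ℕ) * ν.real (unitSphere (N + 1)) - δ) :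
    ν.real (unitSphere (N + 1)) * Real.log (δ / 2 ^ (N + 1))
      + ν.real (unitSphere (N + 1)) / (N + 1) * ∑ k ∈ Finset.range (N + 1), Real.log (a k)
      + δ * (Real.log (a 0) - Real.log (a N)) ≤ logFunc ν K := by
  set m := ν.real (unitSphere (N + 1)) with hm
  set L : ℕ → ℝ := fun k => Real.log (a k) with hL
  set c := Real.log (δ / 2 ^ (N + 1)) with hc
  set B : ℕ → Set (𝔼 (N + 1)) := fun k =>
    unitSphere (N + 1) ∩ {u | ∀ j : Fin (N + 1), (j : ℕ) < k → |⟪e j, u⟫_ℝ| < δ} with hB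
  have hd : ∀ k < N, 0 ≤ L k - L (k + 1) := fun k hk =>
    sub_nonneg.2 (Real.log_le_log (ha _ (by omega)) (hanti _ _ (by omega) (by omega)))
  have hBm : ∀ k, MeasurableSet (B k) := by
    intro k
    refine Metric.isClosed_sphere.measurableSet.inter ?_
    simp only [Set.ofPred_forall]
    exact MeasurableSet.iInter fun i => MeasurableSet.iInter fun j =>
      (isOpen_lt (by fun_prop) continuous_const).measurableSet
  have hpos : ∀ u ∈ unitSphere (N + 1), 0 < suppFn K u := by
    intro u hu
    obtain ⟨j, hj, hju⟩ := exists_coord_ge hon hδ0 hδ (by simpa [unitSphere] using hu)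
    have h1 := hdom u j hj
    have h2 : 0 < a j * |⟪e j, u⟫_ℝ| := mul_pos (ha j hj) (hδ0.trans_le hju)
    exact pos_of_mul_pos_right (h2.trans_le h1) (by positivity)
  have hpt : ∀ u ∈ unitSphere (N + 1),
      c + L 0 - ∑ k ∈ Finset.range N, (B (k + 1)).indicator (fun _ => L k - L (k + 1)) u
        ≤ Real.log (suppFn K u) := by
    intro u hu
    classical
    have hex := exists_coord_ge hon hδ0 hδ (u := u) (by simpa [unitSphere] using hu)
    obtain ⟨hj, hju⟩ := Nat.find_spec hex
    have hmin := fun i hi => Nat.find_min hex (m := i) hi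
    set j := Nat.find hex
    have h1 : L j + c ≤ Real.log (suppFn K u) := by
      rw [hL, hc, ← Real.log_mul (ha j hj).ne' (by positivity)]
      refine Real.log_le_log (mul_pos (ha j hj) (by positivity)) ?_
      rw [← mul_div_assoc, div_le_iff₀ (by positivity), mul_comm _ (2 ^ (N + 1))]
      exact (mul_le_mul_of_nonneg_left hju (ha j hj).le).trans (hdom u j hj)
    have h2 : ∑ k ∈ Finset.range j, (B (k + 1)).indicator (fun _ => L k - L (k + 1)) u
        = L 0 - L j := by
      rw [← Finset.sum_range_sub']
      refine Finset.sum_congr rfl fun k hk => ?_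
      have hk' : k < j := by simpa using hk
      have huB : u ∈ B (k + 1) := by
        refine ⟨hu, fun i hi => ?_⟩
        by_contra hcon
        exact hmin i (by omega) ⟨i.2, not_lt.1 hcon⟩
      exact Set.indicator_of_mem huB _
    have h3 : ∑ k ∈ Finset.range j, (B (k + 1)).indicator (fun _ => L k - L (k + 1)) u
        ≤ ∑ k ∈ Finset.range N, (B (k + 1)).indicator (fun _ => L k - L (k + 1)) u := by
      refine Finset.sum_le_sum_of_subset_of_nonneg (Finset.range_mono (by omega))
        fun k hk _ => Set.indicator_nonneg (fun _ _ => hd k (by simpa using hk)) _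
    linarith
  have hmem : ∀ᵐ u ∂ν, u ∈ unitSphere (N + 1) := hνsupp
  have hrestr : ν.restrict (unitSphere (N + 1)) = ν := Measure.restrict_eq_self_of_ae_mem hmem
  have huniv : ν.real Set.univ = m := by
    rw [hm, ← measureReal_restrict_apply_univ (unitSphere (N + 1)), hrestr]
  have hint : Integrable (fun u => Real.log (suppFn K u)) ν := by
    rw [← hrestr]
    exact ContinuousOn.integrableOn_compact (isCompact_sphere _ _)
      ((continuous_suppFn hK).continuousOn.log fun u hu => (hpos u hu).ne')
  have hindint : ∀ k, Integrable ((B (k + 1)).indicator (fun _ => L k - L (k + 1))) ν :=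
    fun k => (integrable_const _).indicator (hBm _)
  have hsumint : Integrable (fun u =>
      ∑ k ∈ Finset.range N, (B (k + 1)).indicator (fun _ => L k - L (k + 1)) u) ν :=
    integrable_finsetSum _ fun k _ => hindint k
  have hle := integral_mono_ae ((integrable_const (c + L 0)).sub hsumint) hint
    (hmem.mono hpt)
  simp only [Pi.sub_apply] at hle
  rw [integral_sub (integrable_const _) hsumint, integral_finsetSum _ fun k _ => hindint k,
    integral_const, huniv, smul_eq_mul] at hle
  simp only [integral_indicator_const _ (hBm _), smul_eq_mul] at hle
  have hsum : ∑ k ∈ Finset.range N, ν.real (B (k + 1)) * (L k - L (k + 1))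
      ≤ m / (N + 1) * ∑ k ∈ Finset.range N, ((N : ℝ) - k) * (L k - L (k + 1))
        - δ * ∑ k ∈ Finset.range N, (L k - L (k + 1)) := by
    rw [Finset.mul_sum, Finset.mul_sum, ← Finset.sum_sub_distrib]
    refine Finset.sum_le_sum fun k hk => ?_
    have hk' : k < N := by simpa using hk
    have h := mul_le_mul_of_nonneg_right (hconc (k + 1) (by omega) (by omega)) (hd k hk')
    refine h.trans (le_of_eq ?_)
    push_cast
    field_simp
    ring
  rw [sum_range_mul_sub, Finset.sum_range_sub'] at hsum
  have hexp : m / (N + 1) * ((N + 1) * L 0 - ∑ k ∈ Finset.range (N + 1), L k)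
      = m * L 0 - m / (N + 1) * ∑ k ∈ Finset.range (N + 1), L k := by
    field_simp
  have hfin : ∫ u, Real.log (suppFn K u) ∂ν = logFunc ν K := rfl
  rw [hexp] at hsum
  rw [hfin] at hle
  linarith

/-- under the strict subspace concentration inequality, any sequence of
origin-symmetric convex bodies satisfying the constraint `F(Q_l) = ν(S^{n-1})` along which
`Φ_ν` is bounded above is uniformly bounded. -/
theorem minimizing_sequence_bounded (n : ℕ) (hn : 2 ≤ n)
    (ν : Measure (EuclideanSpace ℝ (Fin n))) [IsFiniteMeasure ν]
    (hνsupp : ν (unitSphere n)ᶜ = 0)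
    (hνeven : ν.map (fun x => -x) = ν)
    (hνpos : 0 < ν (unitSphere n))
    (hνscc : ∀ H : Submodule ℝ (EuclideanSpace ℝ (Fin n)),
      0 < Module.finrank ℝ H → Module.finrank ℝ H < n →
      ν ((H : Set (EuclideanSpace ℝ (Fin n))) ∩ unitSphere n)
        < ((Module.finrank ℝ H : ℝ≥0∞) / (n : ℝ≥0∞)) * ν (unitSphere n))
    (α : ℝ) (hα : α ≠ 0)
    (F : Set (EuclideanSpace ℝ (Fin n)) → ℝ)
    (hFpos : ∀ K, IsConvexBody K → 0 < F K)
    (hFcont : ∀ (K : ℕ → Set (EuclideanSpace ℝ (Fin n))) (L),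
      (∀ i, IsConvexBody (K i)) → IsConvexBody L →
      Tendsto (fun i => Metric.hausdorffDist (K i) L) atTop (𝓝 0) →
      Tendsto (fun i => F (K i)) atTop (𝓝 (F L)))
    (hFhom : ∀ K, IsConvexBody K → ∀ t : ℝ, 0 < t → F (t • K) = t ^ α * F K)
    -- property (A): monotonicity
    (hA : ∀ K L, IsConvexBody K → IsConvexBody L → K ⊆ L →
      Real.sign α * F K ≤ Real.sign α * F L)
    -- property (B): isoperimetric-type control by the volume
    (hB : ∃ C : ℝ, 0 < C ∧ ∀ K, IsConvexBody K →
      (F K) ^ (1 / α) ≤ C * (volume K).toReal ^ (1 / (n : ℝ)))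
    (Q : ℕ → Set (EuclideanSpace ℝ (Fin n)))
    (hQ : ∀ l, IsConvexBody (Q l)) (hQsym : ∀ l, Q l = -(Q l))
    (hQF : ∀ l, F (Q l) = (ν (unitSphere n)).toReal)
    (hQΦ : ∃ M : ℝ, ∀ l, logFunc ν (Q l) ≤ M) :
    ∃ R : ℝ, 0 < R ∧ ∀ l, Q l ⊆ Metric.closedBall (0 : EuclideanSpace ℝ (Fin n)) R := by
  obtain ⟨C, hC, hCv⟩ := hB
  obtain ⟨M, hM⟩ := hQΦ
  obtain ⟨N, rfl⟩ : ∃ N, n = N + 1 := ⟨n - 1, by omega⟩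
  set m := ν.real (unitSphere (N + 1)) with hm
  have hm0 : 0 < m := ENNReal.toReal_pos hνpos.ne' (measure_ne_top _ _)
  obtain ⟨δ, hδ0, hδ, hconc⟩ := exists_uniform_concentration hνscc
    (r := 1 / ((N + 1 : ℕ) : ℝ)) (by positivity)
  set v₀ : ℝ := (m ^ (1 / α) / C) ^ (N + 1) with hv₀
  have hv₀pos : 0 < v₀ := by positivity
  have hvol : ∀ l, v₀ ≤ (volume (Q l)).toReal := by
    intro l
    have h := hCv (Q l) (hQ l)
    rw [hQF l, mul_comm, ← div_le_iff₀ hC] at h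
    have h1 : m ^ (1 / α) / C ≤ (volume (Q l)).toReal ^ (1 / ((N + 1 : ℕ) : ℝ)) := h
    have h2 := pow_le_pow_left₀ (by positivity) h1 (N + 1)
    rwa [one_div ((N + 1 : ℕ) : ℝ),
      Real.rpow_inv_natCast_pow ENNReal.toReal_nonneg (Nat.succ_ne_zero N)] at h2
  set s : ℝ := Real.log (v₀ / 2 ^ (N + 1)) with hs
  set b : ℝ := M - m * Real.log (δ / 2 ^ (N + 1)) with hb
  refine ⟨Real.exp ((b - m / (N + 1) * s) / δ + b / m), Real.exp_pos _, fun l => ?_⟩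
  have hne : (Q l).Nonempty := (hQ l).2.2.mono interior_subset
  obtain ⟨e, a, hon, hanti, hbox, hnorm, hdom⟩ := exists_adapted_frame (hQ l).1 hne (hQsym l)
  have ha0 : ∀ i < N + 1, 0 ≤ a i := by
    intro i hi
    obtain ⟨x, hx⟩ := hne
    exact (abs_nonneg _).trans (hbox x hx i hi)
  have hprod : v₀ / 2 ^ (N + 1) ≤ ∏ i ∈ Finset.range (N + 1), a i := by
    rw [div_le_iff₀' (by positivity)]
    exact (hvol l).trans (volume_le_of_subset_box hon ha0 hbox)
  have hprod0 : 0 < ∏ i ∈ Finset.range (N + 1), a i := lt_of_lt_of_le (by positivity) hprod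
  have ha : ∀ i < N + 1, 0 < a i := fun i hi =>
    lt_of_le_of_ne (ha0 i hi) (Finset.prod_ne_zero_iff.1 hprod0.ne' i (by simpa using hi)).symm
  have hsum : s ≤ ∑ k ∈ Finset.range (N + 1), Real.log (a k) := by
    rw [← Real.log_prod fun i hi => (ha i (by simpa using hi)).ne']
    exact Real.log_le_log (by positivity) hprod
  have hlow := (le_logFunc hνsupp (hQ l).1 hon ha hanti hdom hδ0 hδ
    fun k hk0 hk => hconc k hk0 hk _ hon).trans (hM l)
  set S := ∑ k ∈ Finset.range (N + 1), Real.log (a k) with hS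
  have hlast : (N + 1) * Real.log (a N) ≤ S := by
    have := Finset.card_nsmul_le_sum (Finset.range (N + 1)) (fun k => Real.log (a k))
      (Real.log (a N)) fun k hk => by
        have hk' : k < N + 1 := by simpa using hk
        exact Real.log_le_log (ha N (by omega)) (hanti _ _ (by omega) (by omega))
    simpa using this
  have hgap : 0 ≤ Real.log (a 0) - Real.log (a N) :=
    sub_nonneg.2 (Real.log_le_log (ha N (by omega)) (hanti _ _ (by omega) (by omega)))
  have h1 : m / (N + 1) * s ≤ m / (N + 1) * S := mul_le_mul_of_nonneg_left hsum (by positivity)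
  have h2 : m * Real.log (a N) ≤ m / (N + 1) * S := by
    refine le_trans (le_of_eq ?_) (mul_le_mul_of_nonneg_left hlast (by positivity))
    field_simp
  have h3 : Real.log (a 0) - Real.log (a N) ≤ (b - m / (N + 1) * s) / δ := by
    rw [le_div_iff₀ hδ0]
    linarith
  have h4 : Real.log (a N) ≤ b / m := by
    rw [le_div_iff₀ hm0]
    have := mul_nonneg hδ0.le hgap
    linarith
  intro x hx
  rw [mem_closedBall_zero_iff]
  refine (hnorm (by omega) x hx).trans ?_
  rw [← Real.log_le_iff_le_exp (ha 0 (by omega))]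
  linarith
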